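/- arXiv:2406.00254 — 2 statements merged into one kernel-verified Lean document; each statement's English description precedes it below -/
import Mathlib

section
/- Assume (ℓ, d) satisfies the Kupisch dichotomy and that for every i ∈ ZMod n either ℓ(i) ≥ 2, or ℓ(i) = 1 and d(i+1) ≥ 1. Then, for the cyclic sequence K of length N = n + Σ_i d(i), the number of cyclic positions k with K(k) ≤ K(k+1) equals n, and the number of cyclic positions k with K(k) > K(k+1) equals Σ_i d(i). -/
/-- The Kupisch dichotomy: for every `i`, either `l i = l (i+1) + 1` and `d (i+1) = 0`,
or `l i ≤ l (i+1)` and `d (i+1) = l (i+1) - l i`. -/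
def KupischDichotomy (n : ℕ) (l d : ZMod n → ℕ) : Prop :=
  ∀ i : ZMod n, (l i = l (i + 1) + 1 ∧ d (i + 1) = 0) ∨
    (l i ≤ l (i + 1) ∧ d (i + 1) = l (i + 1) - l i)

/-- `aLen n l d i m = l i + ∑_{j=1}^{l i + m} d (i + j)`, the `m`-th entry of the `i`-th
block; for `m = 0` this is the length `c i` of the `i`-th filtered projective. -/
def aLen (n : ℕ) (l d : ZMod n → ℕ) (i : ZMod n) (m : ℕ) : ℕ :=
  l i + ∑ j ∈ Finset.Icc 1 (l i + m), d (i + (j : ZMod n))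

/-- The cyclic sequence `K`: the concatenation over `i = 0, …, n-1` of the blocks
`(aLen i 0, aLen i 1, …, aLen i (d (i+1)))`. -/
def KSeq (n : ℕ) (l d : ZMod n → ℕ) : List ℕ :=
  (List.range n).flatMap (fun i =>
    (List.range (d ((i : ZMod n) + 1) + 1)).map (fun m => aLen n l d (i : ZMod n) m))

/-- The entries of `K` read cyclically. -/
def KFun (n : ℕ) (l d : ZMod n → ℕ) (k : ℕ) : ℕ :=
  (KSeq n l d).getD (k % (KSeq n l d).length) 0

theorem length_flatMap_range_map {α : Type*} (b : ℕ → ℕ) (f : ℕ → ℕ → α) (n : ℕ) :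
    ((List.range n).flatMap fun i => (List.range (b i)).map (f i)).length =
      ∑ i ∈ Finset.range n, b i := by
  induction n with
  | zero => simp
  | succ n ih => rw [List.range_succ, List.flatMap_append, List.length_append, ih,
      Finset.sum_range_succ]; simp

/-- The entry of a concatenation of blocks at position `m` of block `i`. -/
theorem getD_flatMap_range_map {α : Type*} (b : ℕ → ℕ) (f : ℕ → ℕ → α) (x : α)
    {n i m : ℕ} (hi : i < n) (hm : m < b i) :
    ((List.range n).flatMap fun i => (List.range (b i)).map (f i)).getD
      (∑ j ∈ Finset.range i, b j + m) x = f i m := by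
  induction n with
  | zero => omega
  | succ n ih =>
    rw [List.range_succ, List.flatMap_append]
    rcases Nat.lt_succ_iff_lt_or_eq.mp hi with h | rfl
    · rw [List.getD_append _ _ _ _ ?_, ih h]
      rw [length_flatMap_range_map]
      calc _ < ∑ j ∈ Finset.range (i + 1), b j := by rw [Finset.sum_range_succ]; omega
        _ ≤ _ := Finset.sum_le_sum_of_subset (Finset.range_mono h)
    · rw [List.getD_append_right _ _ _ _ (by rw [length_flatMap_range_map]; omega),
        length_flatMap_range_map]
      simp [hm]

/-- A sum over consecutive positions, grouped into blocks of sizes `b 0, b 1, …`. -/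
theorem sum_range_sum_eq_sum_blocks (b g : ℕ → ℕ) (n : ℕ) :
    ∑ k ∈ Finset.range (∑ i ∈ Finset.range n, b i), g k =
      ∑ i ∈ Finset.range n, ∑ m ∈ Finset.range (b i), g (∑ j ∈ Finset.range i, b j + m) := by
  induction n with
  | zero => simp
  | succ n ih => rw [Finset.sum_range_succ, Finset.sum_range_add, ih, Finset.sum_range_succ]

theorem sum_range_zmod_add_one (n : ℕ) (f : ZMod n → ℕ) :
    ∑ i ∈ Finset.range n, f ((i : ZMod n) + 1) = ∑ i ∈ Finset.range n, f i := by
  have h := (Finset.sum_range_succ' (fun i : ℕ => f (i : ZMod n)) n).symm.trans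
    (Finset.sum_range_succ (fun i : ℕ => f (i : ZMod n)) n)
  simpa using h

theorem aLen_succ (n : ℕ) (l d : ZMod n → ℕ) (i : ZMod n) (m : ℕ) :
    aLen n l d i (m + 1) = aLen n l d i m + d (i + ((l i + m + 1 : ℕ) : ZMod n)) := by
  unfold aLen
  rw [← add_assoc, Finset.sum_Icc_succ_top (by omega), ← add_assoc]

theorem sum_Icc_one_succ_shift (n : ℕ) (d : ZMod n → ℕ) (i : ZMod n) (t : ℕ) :
    ∑ j ∈ Finset.Icc 1 (t + 1), d (i + (j : ZMod n)) =
      d (i + 1) + ∑ j ∈ Finset.Icc 1 t, d (i + 1 + (j : ZMod n)) := by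
  induction t with
  | zero => simp
  | succ t ih =>
    rw [Finset.sum_Icc_succ_top (by omega), ih, Finset.sum_Icc_succ_top (by omega), add_assoc]
    congr 3
    push_cast
    ring_nf

/-- The last entry of a block exceeds the first entry of the next block exactly when the length
drops. -/
theorem KupischDichotomy.aLen_gt_iff {n : ℕ} {l d : ZMod n → ℕ} (hk : KupischDichotomy n l d)
    (i : ZMod n) :
    aLen n l d i (d (i + 1)) > aLen n l d (i + 1) 0 ↔ l i = l (i + 1) + 1 := by
  unfold aLen
  rcases hk i with ⟨h, hd⟩ | ⟨h, hd⟩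
  · simp only [h, hd, add_zero, sum_Icc_one_succ_shift, iff_true]
    omega
  · have hs := sum_Icc_one_succ_shift n d i (l (i + 1))
    rw [Finset.sum_Icc_succ_top (by omega)] at hs
    rw [show l i + d (i + 1) = l (i + 1) by omega, add_zero]
    omega

theorem KupischDichotomy.sum_drops {n : ℕ} {l d : ZMod n → ℕ} (hk : KupischDichotomy n l d) :
    (∑ i ∈ Finset.range n, if l (i : ZMod n) = l ((i : ZMod n) + 1) + 1 then 1 else 0) =
      ∑ i ∈ Finset.range n, d (i : ZMod n) := by
  have h : ∑ i ∈ Finset.range n, (l (i : ZMod n) + d ((i : ZMod n) + 1)) =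
      ∑ i ∈ Finset.range n, (l ((i : ZMod n) + 1) +
        if l (i : ZMod n) = l ((i : ZMod n) + 1) + 1 then 1 else 0) := by
    refine Finset.sum_congr rfl fun i _ => ?_
    have := hk i
    split_ifs <;> omega
  rw [Finset.sum_add_distrib, Finset.sum_add_distrib, sum_range_zmod_add_one n l,
    sum_range_zmod_add_one n d] at h
  omega

theorem KSeq_eq_flatMap (n : ℕ) (l d : ZMod n → ℕ) :
    KSeq n l d = (List.range n).flatMap fun i : ℕ =>
      (List.range (d ((i : ZMod n) + 1) + 1)).map fun m => aLen n l d (i : ZMod n) m := by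
  simp [KSeq, List.flatMap_assoc, List.bind_eq_flatMap, List.pure_def]

theorem length_KSeq (n : ℕ) (l d : ZMod n → ℕ) :
    (KSeq n l d).length = ∑ i ∈ Finset.range n, (d ((i : ZMod n) + 1) + 1) := by
  rw [KSeq_eq_flatMap]
  exact length_flatMap_range_map (fun i => d ((i : ZMod n) + 1) + 1) _ n

theorem KFun_block {n : ℕ} (l d : ZMod n → ℕ) {i m : ℕ} (hi : i < n)
    (hm : m ≤ d ((i : ZMod n) + 1)) :
    KFun n l d (∑ j ∈ Finset.range i, (d ((j : ZMod n) + 1) + 1) + m) = aLen n l d i m := by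
  unfold KFun
  rw [Nat.mod_eq_of_lt]
  · rw [KSeq_eq_flatMap]
    exact getD_flatMap_range_map (fun i => d ((i : ZMod n) + 1) + 1)
      (fun i m => aLen n l d (i : ZMod n) m) 0 hi (Nat.lt_succ_of_le hm)
  · rw [length_KSeq]
    calc _ < ∑ j ∈ Finset.range (i + 1), (d ((j : ZMod n) + 1) + 1) := by
          rw [Finset.sum_range_succ]; omega
      _ ≤ _ := Finset.sum_le_sum_of_subset (Finset.range_mono hi)

theorem KFun_block_start {n : ℕ} (hn : 1 ≤ n) (l d : ZMod n → ℕ) {i : ℕ} (hi : i ≤ n) :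
    KFun n l d (∑ j ∈ Finset.range i, (d ((j : ZMod n) + 1) + 1)) = aLen n l d i 0 := by
  rcases hi.lt_or_eq with h | rfl
  · exact KFun_block l d h (Nat.zero_le _)
  · have h0 := KFun_block l d (i := 0) (m := 0) hn (Nat.zero_le _)
    simp only [Finset.range_zero, Finset.sum_empty, add_zero, Nat.cast_zero] at h0
    rw [ZMod.natCast_self, ← h0, ← length_KSeq i l d]
    simp [KFun]

theorem card_drops_KFun {n : ℕ} (hn : 1 ≤ n) {l d : ZMod n → ℕ} (hk : KupischDichotomy n l d) :
    ((Finset.range (KSeq n l d).length).filter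
        (fun k => KFun n l d k > KFun n l d (k + 1))).card =
      ∑ i ∈ Finset.range n, d (i : ZMod n) := by
  rw [Finset.card_filter, length_KSeq, sum_range_sum_eq_sum_blocks, ← hk.sum_drops]
  refine Finset.sum_congr rfl fun i hi => ?_
  have hi := Finset.mem_range.mp hi
  rw [Finset.sum_range_succ, Finset.sum_eq_zero, zero_add]
  · have hs := KFun_block_start hn l d (i := i + 1) hi
    rw [Finset.sum_range_succ, ← add_assoc, Nat.cast_add_one] at hs
    rw [hs, KFun_block l d hi le_rfl]
    simp only [hk.aLen_gt_iff]
  · intro m hm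
    have hm := Finset.mem_range.mp hm
    rw [add_assoc, KFun_block l d hi hm.le, KFun_block l d hi hm, aLen_succ]
    simp

theorem stmt3 (n : ℕ) (hn : 1 ≤ n) (l d : ZMod n → ℕ)
    (hk : KupischDichotomy n l d)
    (hl : ∀ i : ZMod n, 2 ≤ l i ∨ (l i = 1 ∧ 1 ≤ d (i + 1))) :
    (KSeq n l d).length = n + ∑ i ∈ Finset.range n, d (i : ZMod n) ∧
    ((Finset.range (KSeq n l d).length).filter
        (fun k => KFun n l d k ≤ KFun n l d (k + 1))).card = n ∧
    ((Finset.range (KSeq n l d).length).filter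
        (fun k => KFun n l d k > KFun n l d (k + 1))).card =
      ∑ i ∈ Finset.range n, d (i : ZMod n) := by
  have hlen : (KSeq n l d).length = n + ∑ i ∈ Finset.range n, d (i : ZMod n) := by
    rw [length_KSeq, Finset.sum_add_distrib, sum_range_zmod_add_one n d]
    simp [add_comm]
  have hgt := card_drops_KFun hn hk
  refine ⟨hlen, ?_, hgt⟩
  have h := Finset.card_filter_add_card_filter_not (s := Finset.range (KSeq n l d).length)
    (fun k => KFun n l d k ≤ KFun n l d (k + 1))
  simp only [not_le, Finset.card_range] at h
  simp only [gt_iff_lt] at hgt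
  omega
end

section
/- Let d := #{i ∈ ZMod n : f(i) = 2} and assume d ≥ 1. Define the cyclic sequence K of length N = n + d as the concatenation, over i = 0, 1, …, n−1 in this cyclic order, of blocks: block i is the single entry c(i) if f(i) = 1, and the pair (c(i), 1 + c(i+1)) if f(i) = 2; positions of K are read cyclically. Then the number of cyclic positions k with K(k) > K(k+1) equals d, and the number of cyclic positions k with K(k) ≤ K(k+1) equals n. -/
/-- `cSelf n m f i = ∑_{j=0}^{m-1} f (i + j)`, where `m` is the common length of the
indecomposable projectives of a selfinjective cyclic Nakayama algebra of rank `n` and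
`f : ZMod n → ℕ` (with values in `{1, 2}`) records the lengths of the base-set modules. -/
def cSelf (n m : ℕ) (f : ZMod n → ℕ) (i : ZMod n) : ℕ :=
  ∑ j ∈ Finset.range m, f (i + (j : ZMod n))

/-- The cyclic sequence `K`: the concatenation over `i = 0, …, n-1` of the blocks which
are the single entry `c i` when `f i = 1`, and the pair `(c i, 1 + c (i+1))` when
`f i = 2`. -/
def KSelf (n m : ℕ) (f : ZMod n → ℕ) : List ℕ :=
  (List.range n).flatMap (fun i =>
    if f (i : ZMod n) = 2 then
      [cSelf n m f (i : ZMod n), 1 + cSelf n m f ((i : ZMod n) + 1)]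
    else
      [cSelf n m f (i : ZMod n)])

/-- The entries of `K` read cyclically. -/
def KFunSelf (n m : ℕ) (f : ZMod n → ℕ) (k : ℕ) : ℕ :=
  (KSelf n m f).getD (k % (KSelf n m f).length) 0

/-- The block of `KSelf` contributed by the index `i`. -/
def blockSelf (n m : ℕ) (f : ZMod n → ℕ) (i : ℕ) : List ℕ :=
  if f (i : ZMod n) = 2 then
    [cSelf n m f (i : ZMod n), 1 + cSelf n m f ((i : ZMod n) + 1)]
  else
    [cSelf n m f (i : ZMod n)]

/-- The number of entries in the first `p` blocks of `KSelf`. -/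
def blockStart (n : ℕ) (f : ZMod n → ℕ) (p : ℕ) : ℕ :=
  p + ((Finset.range p).filter (fun i : ℕ => f (i : ZMod n) = 2)).card

lemma card_filter_range_succ (p : ℕ → Prop) [DecidablePred p] (k : ℕ) :
    ((Finset.range (k + 1)).filter p).card =
      ((Finset.range k).filter p).card + if p k then 1 else 0 := by
  simp only [Finset.card_filter, Finset.sum_range_succ]

lemma blockStart_succ (n : ℕ) (f : ZMod n → ℕ) (p : ℕ) :
    blockStart n f (p + 1) = blockStart n f p + if f (p : ZMod n) = 2 then 2 else 1 := by
  unfold blockStart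
  rw [card_filter_range_succ]
  split_ifs <;> omega

lemma length_flatMap_blockSelf (n m : ℕ) (f : ZMod n → ℕ) (p : ℕ) :
    ((List.range p).flatMap (blockSelf n m f)).length = blockStart n f p := by
  induction p with
  | zero => simp [blockStart]
  | succ p ih =>
    rw [List.range_succ, List.flatMap_append, List.length_append, ih, blockStart_succ]
    simp only [blockSelf, List.flatMap_singleton]
    split_ifs <;> simp

lemma KSelf_eq_flatMap (n m : ℕ) (f : ZMod n → ℕ) :
    KSelf n m f = (List.range n).flatMap (blockSelf n m f) := by
  simp only [KSelf, List.bind_eq_flatMap, List.pure_def, List.flatMap_assoc,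
    List.flatMap_singleton]
  rfl

lemma length_KSelf (n m : ℕ) (f : ZMod n → ℕ) :
    (KSelf n m f).length = blockStart n f n := by
  rw [KSelf_eq_flatMap, length_flatMap_blockSelf]

lemma KSelf_eq_append (n m : ℕ) (f : ZMod n → ℕ) {p : ℕ} (hp : p < n) :
    ∃ l, KSelf n m f =
      (List.range p).flatMap (blockSelf n m f) ++ (blockSelf n m f p ++ l) := by
  obtain ⟨r, hr⟩ := Nat.exists_eq_add_of_lt hp
  refine ⟨((List.range r).map (p + 1 + ·)).flatMap (blockSelf n m f), ?_⟩
  have h : List.range n = List.range p ++ ([p] ++ (List.range r).map (p + 1 + ·)) := by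
    rw [← List.append_assoc, ← List.range_succ, ← List.range_add]
    congr 1
    omega
  rw [KSelf_eq_flatMap, h, List.flatMap_append, List.flatMap_append, List.flatMap_singleton]

lemma blockStart_mono (n : ℕ) (f : ZMod n → ℕ) : Monotone (blockStart n f) :=
  monotone_nat_of_le_succ fun p => by rw [blockStart_succ]; omega

lemma KFunSelf_of_lt (n m : ℕ) (f : ZMod n → ℕ) {k : ℕ} (hk : k < blockStart n f n) :
    KFunSelf n m f k = (KSelf n m f).getD k 0 := by
  rw [KFunSelf, Nat.mod_eq_of_lt (by rwa [length_KSelf])]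

lemma KFunSelf_blockStart_of_lt (n m : ℕ) (f : ZMod n → ℕ) {p : ℕ} (hp : p < n) :
    KFunSelf n m f (blockStart n f p) = cSelf n m f p := by
  have hlt := blockStart_mono n f (Nat.succ_le_of_lt hp)
  rw [Nat.succ_eq_add_one, blockStart_succ] at hlt
  obtain ⟨l, hl⟩ := KSelf_eq_append n m f hp
  rw [KFunSelf_of_lt n m f (by split_ifs at hlt <;> omega), hl,
    List.getD_append_right _ _ _ _ (length_flatMap_blockSelf n m f p).le,
    length_flatMap_blockSelf, Nat.sub_self, blockSelf]
  split_ifs <;> simp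

lemma KFunSelf_blockStart_add_one (n m : ℕ) (f : ZMod n → ℕ) {p : ℕ} (hp : p < n)
    (h2 : f (p : ZMod n) = 2) :
    KFunSelf n m f (blockStart n f p + 1) = 1 + cSelf n m f ((p : ZMod n) + 1) := by
  have hlt := blockStart_mono n f (Nat.succ_le_of_lt hp)
  rw [Nat.succ_eq_add_one, blockStart_succ, if_pos h2] at hlt
  obtain ⟨l, hl⟩ := KSelf_eq_append n m f hp
  rw [KFunSelf_of_lt n m f (by omega), hl,
    List.getD_append_right _ _ _ _ (by rw [length_flatMap_blockSelf]; omega),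
    length_flatMap_blockSelf, Nat.add_sub_cancel_left, blockSelf, if_pos h2]
  simp

lemma KFunSelf_blockStart (n m : ℕ) (f : ZMod n → ℕ) (hn : 1 ≤ n) {p : ℕ} (hp : p ≤ n) :
    KFunSelf n m f (blockStart n f p) = cSelf n m f p := by
  rcases hp.lt_or_eq with hp | rfl
  · exact KFunSelf_blockStart_of_lt n m f hp
  · have h0 := KFunSelf_blockStart_of_lt p m f hn
    have hz : blockStart p f 0 = 0 := by simp [blockStart]
    rw [hz, Nat.cast_zero] at h0
    rw [ZMod.natCast_self, ← h0, KFunSelf, KFunSelf, length_KSelf, Nat.mod_self, Nat.zero_mod]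

lemma cSelf_add_one (n m : ℕ) (f : ZMod n → ℕ) (i : ZMod n) :
    cSelf n m f (i + 1) + f i = cSelf n m f i + f (i + m) := by
  have h := Finset.sum_range_succ' (fun j : ℕ => f (i + j)) m
  rw [Finset.sum_range_succ] at h
  simp only [Nat.cast_zero, add_zero, Nat.cast_add, Nat.cast_one] at h
  simp only [cSelf, h, add_assoc, add_comm (1 : ZMod n)]

lemma card_descents_KFunSelf (n m : ℕ) (hn : 1 ≤ n) (f : ZMod n → ℕ)
    (hf : ∀ i : ZMod n, f i = 1 ∨ f i = 2) {p : ℕ} (hp : p ≤ n) :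
    ((Finset.range (blockStart n f p)).filter
        (fun k => KFunSelf n m f k > KFunSelf n m f (k + 1))).card =
      ((Finset.range p).filter (fun i : ℕ => f (i : ZMod n) = 2)).card := by
  induction p with
  | zero => simp [blockStart]
  | succ p ih =>
    have hc := cSelf_add_one n m f p
    have hfm := hf ((p : ZMod n) + m)
    have hstart := KFunSelf_blockStart n m f hn (Nat.le_of_succ_le hp)
    have hnext := KFunSelf_blockStart n m f hn hp
    rw [Nat.cast_add, Nat.cast_one] at hnext
    rw [card_filter_range_succ (fun i : ℕ => f (i : ZMod n) = 2), ← ih (Nat.le_of_succ_le hp)]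
    rw [blockStart_succ] at hnext ⊢
    by_cases h2 : f (p : ZMod n) = 2
    · have hmid := KFunSelf_blockStart_add_one n m f hp h2
      simp only [if_pos h2] at hnext ⊢
      rw [card_filter_range_succ, card_filter_range_succ, hstart, hmid, add_assoc _ 1 1, hnext,
        if_neg (by omega), if_pos (by omega)]
    · have h1 := (hf p).resolve_right h2
      simp only [if_neg h2] at hnext ⊢
      rw [card_filter_range_succ, hstart, hnext, if_neg (by omega)]

theorem stmt10 (n m : ℕ) (hn : 1 ≤ n) (hm : 2 ≤ m) (f : ZMod n → ℕ)
    (hf : ∀ i : ZMod n, f i = 1 ∨ f i = 2)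
    (hd : 1 ≤ ((Finset.range n).filter (fun i : ℕ => f ((i : ℕ) : ZMod n) = 2)).card) :
    (KSelf n m f).length =
      n + ((Finset.range n).filter (fun i : ℕ => f ((i : ℕ) : ZMod n) = 2)).card ∧
    ((Finset.range (KSelf n m f).length).filter
        (fun k => KFunSelf n m f k > KFunSelf n m f (k + 1))).card =
      ((Finset.range n).filter (fun i : ℕ => f ((i : ℕ) : ZMod n) = 2)).card ∧
    ((Finset.range (KSelf n m f).length).filter
        (fun k => KFunSelf n m f k ≤ KFunSelf n m f (k + 1))).card = n := by
  have hlen := length_KSelf n m f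
  have hdesc := card_descents_KFunSelf n m hn f hf le_rfl
  have hsum := Finset.card_filter_add_card_filter_not (s := Finset.range (blockStart n f n))
    (fun k => KFunSelf n m f k > KFunSelf n m f (k + 1))
  simp only [not_lt, gt_iff_lt, Finset.card_range] at hsum hdesc
  simp only [gt_iff_lt, hlen]
  refine ⟨rfl, hdesc, ?_⟩
  rw [hdesc, blockStart] at hsum
  rw [blockStart]
  omega
end
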